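/- arXiv:2212.03619 — 2 statements merged into one kernel-verified Lean document; each statement's English description precedes it below -/
import Mathlib

section
/- Let x ∈ [0,1]. Then there exists a function ψ : ℕ → [0,∞) such that the Lebesgue measure of 𝔄^∞(ψ) equals x and the Lebesgue measure of 𝔎^∞(ψ) equals x. (In fact ψ(n) = nx for n prime and ψ(n) = 0 otherwise works.) -/
open MeasureTheory Filter Set

namespace DS

/-- The set `𝔄^∞(ψ)`: the set of `α ∈ [0,1]` such that `|α - a/b| ≤ ψ(|ab|)/|ab|` for
infinitely many reduced fractions `a/b` with `a ∈ ℤ ∖ {0}`, `b ∈ ℕ`, `gcd(a,b) = 1`. -/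
def fAR (ψ : ℕ → ℝ) : Set ℝ :=
  {α : ℝ | α ∈ Set.Icc (0 : ℝ) 1 ∧
    {q : ℤ × ℕ | q.1 ≠ 0 ∧ 0 < q.2 ∧ Int.gcd q.1 q.2 = 1 ∧
      |α - (q.1 : ℝ) / (q.2 : ℝ)| ≤ ψ (q.1.natAbs * q.2) / (q.1.natAbs * q.2 : ℝ)}.Infinite}

/-- The set `𝔎^∞(ψ)`: the set of `α ∈ [0,1]` such that `|α - a/b| ≤ ψ(|ab|)/|ab|` for
infinitely many pairs `(a, b) ∈ (ℤ ∖ {0}) × ℕ`. -/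
def fKR (ψ : ℕ → ℝ) : Set ℝ :=
  {α : ℝ | α ∈ Set.Icc (0 : ℝ) 1 ∧
    {q : ℤ × ℕ | q.1 ≠ 0 ∧ 0 < q.2 ∧
      |α - (q.1 : ℝ) / (q.2 : ℝ)| ≤ ψ (q.1.natAbs * q.2) / (q.1.natAbs * q.2 : ℝ)}.Infinite}



lemma fAR_subset_fKR (ψ : ℕ → ℝ) : fAR ψ ⊆ fKR ψ := by
  rintro α ⟨h1, h2⟩
  refine ⟨h1, h2.mono ?_⟩
  rintro q ⟨ha, hb, _, hc⟩
  exact ⟨ha, hb, hc⟩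

lemma Ioo_subset_fAR (x : ℝ) (hx : x ∈ Set.Icc (0 : ℝ) 1) (ψ : ℕ → ℝ)
    (hp : ∀ n : ℕ, n.Prime → ψ n = n * x) : Set.Ioo 0 x ⊆ fAR ψ := by
  rintro α ⟨h0, h1⟩
  refine ⟨⟨h0.le, h1.le.trans hx.2⟩, ?_⟩
  have hx0 : 0 < x := h0.trans h1
  obtain ⟨N, hN⟩ := exists_nat_gt (1 / x)
  have hinf : {p : ℕ | N ≤ p ∧ p.Prime}.Infinite := by
    rw [Set.infinite_iff_exists_gt]
    intro a
    obtain ⟨p, hp1, hp2⟩ := Nat.exists_infinite_primes (max (a + 1) N)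
    exact ⟨p, ⟨(le_max_right _ _).trans hp1, hp2⟩, (le_max_left _ _).trans hp1⟩
  have hinj : Function.Injective (fun p : ℕ => ((1 : ℤ), p)) := by
    intro a b h
    simpa using h
  refine (hinf.image hinj.injOn).mono ?_
  rintro _ ⟨p, ⟨hNp, hpp⟩, rfl⟩
  have hp0 : (0 : ℝ) < p := by exact_mod_cast hpp.pos
  refine ⟨one_ne_zero, hpp.pos, by simp, ?_⟩
  have h2 : 1 / x < p := hN.trans_le (by exact_mod_cast hNp)
  have h3 : 1 / (p : ℝ) < x := by
    rw [div_lt_iff₀ hx0] at h2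
    rw [div_lt_iff₀ hp0]
    linarith
  have h4 : 0 < 1 / (p : ℝ) := by positivity
  simp only [Int.natAbs_one, one_mul, Int.cast_one, Nat.cast_one]
  rw [hp p hpp, mul_div_cancel_left₀ _ hp0.ne', abs_le]
  constructor <;> linarith

lemma fKR_subset (x : ℝ) (hx : x ∈ Set.Icc (0 : ℝ) 1) (ψ : ℕ → ℝ)
    (hp : ∀ n : ℕ, n.Prime → ψ n = n * x) (hn : ∀ n : ℕ, ¬ n.Prime → ψ n = 0) :
    fKR ψ ⊆ Set.Icc 0 x ∪ Set.range ((↑) : ℚ → ℝ) := by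
  rintro α ⟨h01, hinf⟩
  by_contra hcon
  rw [Set.mem_union, not_or] at hcon
  obtain ⟨hα, hirr⟩ := hcon
  have hxα : x < α := by
    by_contra h
    exact hα ⟨h01.1, not_lt.mp h⟩
  obtain ⟨N, hN⟩ := exists_nat_gt (1 / (α - x))
  apply hinf
  refine ((Set.finite_Icc (-2 : ℤ) 2).prod (Set.finite_Iic (N + 1))).subset ?_
  rintro ⟨a, b⟩ ⟨ha, hb, hab⟩
  simp only at ha hb hab
  have hb0 : (0 : ℝ) < b := by exact_mod_cast hb
  by_cases hpr : (a.natAbs * b).Prime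
  · have hne : ((a.natAbs * b : ℕ) : ℝ) ≠ 0 := by exact_mod_cast hpr.ne_zero
    rw [hp _ hpr, ← Nat.cast_mul, mul_div_cancel_left₀ _ hne, abs_le] at hab
    rcases Nat.prime_mul_iff.mp hpr with ⟨_, h1⟩ | ⟨_, h1⟩
    · subst h1
      simp only [Nat.cast_one, div_one] at hab
      have h2 : (a : ℝ) ≤ 2 := by linarith [h01.2, hx.2]
      have h3 : (-2 : ℝ) ≤ a := by linarith [h01.1, hx.2]
      refine ⟨⟨by exact_mod_cast h3, by exact_mod_cast h2⟩, ?_⟩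
      simp
    · have h2 : a ≤ 1 := by omega
      refine ⟨⟨by simp only; omega, by simp only; omega⟩, ?_⟩
      have h3 : (a : ℝ) / b ≤ 1 / b := by
        gcongr
        exact_mod_cast h2
      have h4 : α - x ≤ 1 / b := by linarith
      have h5 : (b : ℝ) ≤ 1 / (α - x) := by
        rw [le_div_iff₀ hb0] at h4
        rw [le_div_iff₀ (by linarith)]
        linarith
      have h6 : (b : ℝ) < N := h5.trans_lt hN
      have h7 : b < N := by exact_mod_cast h6
      simp only [Set.mem_Iic]
      omega
  · exfalso
    rw [hn _ hpr, zero_div] at hab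
    have h := abs_eq_zero.mp (le_antisymm hab (abs_nonneg _))
    exact hirr ⟨(a : ℚ) / b, by push_cast; linarith⟩

/-- **Theorem 2 for `p = ∞`**: for every `x ∈ [0,1]` there is a `ψ : ℕ → [0,∞)` such that
`𝔄^∞(ψ)` and `𝔎^∞(ψ)` both have Lebesgue measure `x`; in fact `ψ` supported on the primes
with `ψ(n) = n·x` there works. -/
theorem spectrum_fA_fK_real (x : ℝ) (hx : x ∈ Set.Icc (0 : ℝ) 1) :
    ∃ ψ : ℕ → ℝ, (∀ n, 0 ≤ ψ n) ∧ (∀ n : ℕ, n.Prime → ψ n = n * x) ∧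
      (∀ n : ℕ, ¬ n.Prime → ψ n = 0) ∧
      volume (fAR ψ) = ENNReal.ofReal x ∧ volume (fKR ψ) = ENNReal.ofReal x := by
  classical
  let ψ : ℕ → ℝ := fun n => if n.Prime then n * x else 0
  have hp : ∀ n : ℕ, n.Prime → ψ n = n * x := fun n h => if_pos h
  have hn : ∀ n : ℕ, ¬ n.Prime → ψ n = 0 := fun n h => if_neg h
  have hlo : ENNReal.ofReal x ≤ volume (fAR ψ) := by
    have := measure_mono (μ := volume) (Ioo_subset_fAR x hx ψ hp)
    simpa using this
  have hmid : volume (fAR ψ) ≤ volume (fKR ψ) := measure_mono (fAR_subset_fKR ψ)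
  have hhi : volume (fKR ψ) ≤ ENNReal.ofReal x := by
    refine (measure_mono (fKR_subset x hx ψ hp hn)).trans ((measure_union_le _ _).trans ?_)
    rw [(Set.countable_range ((↑) : ℚ → ℝ)).measure_zero volume]
    simp
  refine ⟨ψ, ?_, hp, hn, le_antisymm (hmid.trans hhi) hlo, le_antisymm hhi (hlo.trans hmid)⟩
  intro n
  by_cases h : n.Prime
  · rw [hp n h]
    exact mul_nonneg n.cast_nonneg hx.1
  · rw [hn n h]

end DS
end

section
/- Let p be a prime, n ∈ ℕ, k = ν_p(n), ñ = n/p^k, let N > k be an integer, and let b ∈ ℤ with p ∤ b. Set A = {a ∈ ℤ : |a| < n, gcd(a, n) = 1, a ≡ b (mod p^{N−k})}. Then |#A − 2 p^{2k−N} φ(ñ)| ≤ 2^{ω(ñ)}. -/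
open Set

namespace DS

/-- Elements of a residue class in a symmetric open interval. -/
lemma class_count (n : ℕ) (hn : 0 < n) (m : ℕ) (hm : 0 < m) (c : ℤ) :
    |(((Finset.Ioc (-(n : ℤ)) (n - 1)).filter (fun a => (m : ℤ) ∣ a - c)).card : ℝ)
      - 2 * n / m| ≤ 1 := by
  have h1 := Int.Ioc_filter_modEq_card (-(n : ℤ)) ((n : ℤ) - 1) (r := (m : ℤ))
    (by exact_mod_cast hm) c
  have h2 : (Finset.Ioc (-(n : ℤ)) (n - 1)).filter (fun a => (m : ℤ) ∣ a - c) =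
      (Finset.Ioc (-(n : ℤ)) (n - 1)).filter (fun a => a ≡ c [ZMOD (m : ℤ)]) := by
    apply Finset.filter_congr
    intro a _
    rw [Int.modEq_comm, Int.modEq_iff_dvd]
  rw [h2]
  have e1 : ⌊(((n : ℤ) - 1 : ℤ) - (c : ℚ)) / ((m : ℤ) : ℚ)⌋ = ((n : ℤ) - 1 - c) / (m : ℤ) := by
    rw [← Int.cast_sub]
    exact Rat.floor_intCast_div_natCast _ _
  have e2 : ⌊((-(n : ℤ) : ℤ) - (c : ℚ)) / ((m : ℤ) : ℚ)⌋ = (-(n : ℤ) - c) / (m : ℤ) := by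
    rw [← Int.cast_sub]
    exact Rat.floor_intCast_div_natCast _ _
  rw [e1, e2] at h1
  have hm' : (0 : ℤ) < m := by exact_mod_cast hm
  have hle : (-(n : ℤ) - c) / (m : ℤ) ≤ ((n : ℤ) - 1 - c) / (m : ℤ) :=
    Int.ediv_le_ediv hm' (by omega)
  rw [max_eq_left (by omega)] at h1
  generalize Finset.card _ = C at h1 ⊢
  have a1 := Int.mul_ediv_add_emod ((n : ℤ) - 1 - c) m
  have a2 := Int.emod_nonneg ((n : ℤ) - 1 - c) hm'.ne'
  have a3 := Int.emod_lt_of_pos ((n : ℤ) - 1 - c) hm'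
  have b1 := Int.mul_ediv_add_emod (-(n : ℤ) - c) m
  have b2 := Int.emod_nonneg (-(n : ℤ) - c) hm'.ne'
  have b3 := Int.emod_lt_of_pos (-(n : ℤ) - c) hm'
  have u1 : (m : ℤ) * C ≤ 2 * n + m := by rw [h1, mul_sub]; omega
  have u2 : 2 * n - m ≤ (m : ℤ) * C := by rw [h1, mul_sub]; omega
  have u1' : (m : ℝ) * C ≤ 2 * n + m := by exact_mod_cast u1
  have u2' : 2 * n - m ≤ (m : ℝ) * C := by exact_mod_cast u2
  have hmR : (0 : ℝ) < m := by exact_mod_cast hm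
  have e : (C : ℝ) - 2 * n / m = (m * C - 2 * n) / m := by field_simp
  rw [e, abs_div, abs_of_pos hmR, div_le_one hmR, abs_le]
  constructor <;> linarith

lemma crt_class (n : ℕ) (hn : 0 < n) (d q : ℕ) (hd : 0 < d) (hq : 0 < q)
    (h : Nat.Coprime d q) (b : ℤ) :
    |(((Finset.Ioc (-(n : ℤ)) (n - 1)).filter
      (fun a => (q : ℤ) ∣ a - b ∧ (d : ℤ) ∣ a)).card : ℝ) - 2 * n / (d * q)| ≤ 1 := by
  have hc : IsCoprime (d : ℤ) (q : ℤ) := Nat.isCoprime_iff_coprime.mpr h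
  obtain ⟨u, v, huv⟩ := hc
  have := class_count n hn (d * q) (by positivity) (u * d * b)
  push_cast at this
  convert this using 6
  rename_i a _
  have key : u * d * b - b = q * (-v * b) := by linear_combination b * huv
  have e1 : ((q : ℤ) ∣ a - b) ↔ (q : ℤ) ∣ a - u * d * b := by
    rw [← dvd_add_left (a := (q : ℤ)) (b := a - u * d * b) (c := u * d * b - b) ⟨_, key⟩]
    ring_nf
  have e2 : ((d : ℤ) ∣ a) ↔ (d : ℤ) ∣ a - u * d * b := by
    rw [dvd_sub_left]
    exact ⟨u * b, by ring⟩
  rw [e1, e2]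
  constructor
  · rintro ⟨h1, h2⟩
    exact IsCoprime.mul_dvd ⟨u, v, huv⟩ h2 h1
  · intro h
    exact ⟨(Dvd.intro_left _ rfl).trans h, (Dvd.intro _ rfl).trans h⟩

lemma moebius_ind (M : ℕ) (hM : 0 < M) (a : ℤ) :
    (if Int.gcd a M = 1 then (1 : ℝ) else 0) =
      ∑ d ∈ M.divisors, if (d : ℤ) ∣ a then (ArithmeticFunction.moebius d : ℝ) else 0 := by
  rw [← Finset.sum_filter]
  have : M.divisors.filter (fun d : ℕ => (d : ℤ) ∣ a) = (Int.gcd a M).divisors := by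
    ext d
    simp only [Finset.mem_filter, Nat.mem_divisors, Int.natCast_dvd, Int.gcd, Int.natAbs_natCast,
      Nat.dvd_gcd_iff]
    have hM0 : M ≠ 0 := hM.ne'
    have : Nat.gcd a.natAbs M ≠ 0 := (Nat.gcd_pos_of_pos_right _ hM).ne'
    tauto
  rw [this]
  have h := congrArg (fun f : ArithmeticFunction ℤ => f (Int.gcd a M))
    ArithmeticFunction.coe_zeta_mul_moebius
  simp only [ArithmeticFunction.coe_zeta_mul_apply, ArithmeticFunction.one_apply] at h
  have h' := congrArg (fun x : ℤ => (x : ℝ)) h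
  push_cast at h'
  exact h'.symm

lemma moebius_tot (M : ℕ) (hM : 0 < M) :
    ∑ d ∈ M.divisors, (ArithmeticFunction.moebius d : ℝ) * (M / d) = M.totient := by
  have := (ArithmeticFunction.sum_eq_iff_sum_mul_moebius_eq
    (f := fun m : ℕ => (m.totient : ℝ)) (g := fun m => (m : ℝ))).1
    (fun m _ => by exact_mod_cast Nat.sum_totient m) M hM
  rw [← this, Nat.sum_divisorsAntidiagonal
    (f := fun x y => (ArithmeticFunction.moebius x : ℝ) * (y : ℝ))]
  apply Finset.sum_congr rfl
  intro d hd
  rw [Nat.cast_div (Nat.dvd_of_mem_divisors hd)]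
  exact_mod_cast (Nat.pos_of_mem_divisors hd).ne'

lemma moebius_abs (M : ℕ) (hM : 0 < M) :
    ∑ d ∈ M.divisors, |(ArithmeticFunction.moebius d : ℝ)| = 2 ^ M.primeFactors.card := by
  have h : ∀ d, |(ArithmeticFunction.moebius d : ℝ)| = if Squarefree d then 1 else 0 := by
    intro d
    rw [← Int.cast_abs, ArithmeticFunction.abs_moebius]
    split_ifs <;> simp
  simp only [h]
  rw [← Finset.sum_filter, Nat.sum_divisors_filter_squarefree hM.ne']
  simp only [Finset.sum_const, Finset.card_powerset, nsmul_eq_mul, mul_one]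
  push_cast
  congr 2
  rw [Nat.factors_eq]
  rfl

/-- The counting estimate from the proof of Lemma 5: with `k = ν_p(n)`, `ñ = n/p^k`, `N > k`
and `p ∤ b`, the number of `a ∈ ℤ` with `|a| < n`, `gcd(a,n) = 1` and `a ≡ b (mod p^{N-k})`
differs from `2 p^{2k-N} φ(ñ)` by at most `2^{ω(ñ)}`. -/
theorem count_coprime_in_progression (p : ℕ) [Fact p.Prime] (n : ℕ) (hn : 0 < n) (k : ℕ)
    (hk : k = padicValNat p n) (N : ℕ) (hN : k < N) (b : ℤ) (hb : ¬ (p : ℤ) ∣ b) :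
    |({a : ℤ | |a| < (n : ℤ) ∧ Int.gcd a n = 1 ∧ (p : ℤ) ^ (N - k) ∣ a - b}.ncard : ℝ) -
        2 * (p : ℝ) ^ (2 * (k : ℤ) - (N : ℤ)) * ((n / p ^ k : ℕ).totient : ℝ)| ≤
      2 ^ (n / p ^ k : ℕ).primeFactors.card := by
  have hp : p.Prime := Fact.out
  obtain ⟨M, hM⟩ : p ^ k ∣ n := hk ▸ pow_padicValNat_dvd
  have hpk : 0 < p ^ k := pow_pos hp.pos k
  have hdiv : n / p ^ k = M := by rw [hM, Nat.mul_div_cancel_left _ hpk]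
  rw [hdiv]
  have hMpos : 0 < M := Nat.pos_of_ne_zero (by rintro rfl; simp at hM; omega)
  have hpM : ¬ p ∣ M := by
    rintro ⟨t, rfl⟩
    have : p ^ (padicValNat p n + 1) ∣ n := by
      rw [← hk]; exact ⟨t, by rw [hM]; ring⟩
    exact pow_succ_padicValNat_not_dvd hn.ne' this
  have hcop : Nat.Coprime p M := (Nat.Prime.coprime_iff_not_dvd hp).2 hpM
  set q := p ^ (N - k) with hq
  have hqpos : 0 < q := pow_pos hp.pos _
  have hqc : (p : ℤ) ^ (N - k) = (q : ℤ) := by rw [hq]; push_cast; rfl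
  have hpq : (p : ℤ) ∣ (q : ℤ) := by
    rw [← hqc]; exact dvd_pow_self _ (by omega)
  set S := (Finset.Ioc (-(n : ℤ)) (n - 1)).filter (fun a => (q : ℤ) ∣ a - b) with hS
  have hset : {a : ℤ | |a| < (n : ℤ) ∧ Int.gcd a n = 1 ∧ (p : ℤ) ^ (N - k) ∣ a - b} =
      ((S.filter (fun a => Int.gcd a M = 1) : Finset ℤ) : Set ℤ) := by
    ext a
    simp only [Set.mem_ofPred_eq, hqc, hS, Finset.coe_filter, Finset.mem_filter, Finset.mem_Ioc,
      abs_lt]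
    have key : (q : ℤ) ∣ a - b → (Int.gcd a n = 1 ↔ Int.gcd a M = 1) := by
      intro h
      have hpa : ¬ p ∣ a.natAbs := by
        intro h'
        apply hb
        have h2 : (p : ℤ) ∣ a := Int.natCast_dvd.mpr h'
        have := dvd_sub h2 (hpq.trans h)
        simpa using this
      have hc : Nat.Coprime a.natAbs (p ^ k) :=
        (((Nat.Prime.coprime_iff_not_dvd hp).2 hpa).symm).pow_right k
      simp only [Int.gcd, Int.natAbs_natCast]
      change Nat.Coprime _ _ ↔ Nat.Coprime _ _
      rw [hM, Nat.coprime_mul_iff_right]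
      exact ⟨fun h => h.2, fun h => ⟨hc, h⟩⟩
    constructor
    · rintro ⟨⟨h1, h2⟩, h3, h4⟩
      exact ⟨⟨⟨h1, by omega⟩, h4⟩, (key h4).1 h3⟩
    · rintro ⟨⟨⟨h1, h2⟩, h4⟩, h3⟩
      exact ⟨⟨h1, by omega⟩, (key h4).2 h3, h4⟩
  rw [hset, Set.ncard_coe_finset]
  have hcount : ((S.filter (fun a => Int.gcd a M = 1)).card : ℝ) =
      ∑ d ∈ M.divisors, (ArithmeticFunction.moebius d : ℝ) *
        (((Finset.Ioc (-(n : ℤ)) (n - 1)).filter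
          (fun a => (q : ℤ) ∣ a - b ∧ (d : ℤ) ∣ a)).card : ℝ) := by
    rw [Finset.card_filter]
    push_cast
    rw [Finset.sum_congr rfl (fun a _ => moebius_ind M hMpos a), Finset.sum_comm]
    apply Finset.sum_congr rfl
    intro d _
    rw [← Finset.sum_filter, Finset.sum_const, nsmul_eq_mul, mul_comm, hS, Finset.filter_filter]
  have hpR : (p : ℝ) ≠ 0 := by exact_mod_cast hp.ne_zero
  have hqR : (q : ℝ) ≠ 0 := by exact_mod_cast hqpos.ne'
  have hmain : 2 * (p : ℝ) ^ (2 * (k : ℤ) - (N : ℤ)) * (M.totient : ℝ) =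
      ∑ d ∈ M.divisors, (ArithmeticFunction.moebius d : ℝ) * (2 * n / (d * q)) := by
    have hz : (p : ℝ) ^ (2 * (k : ℤ) - (N : ℤ)) = (p : ℝ) ^ k / q := by
      rw [hq]; push_cast
      rw [← zpow_natCast, ← zpow_natCast, ← zpow_sub₀ hpR]
      congr 1
      omega
    rw [hz, ← moebius_tot M hMpos, Finset.mul_sum]
    apply Finset.sum_congr rfl
    intro d hd
    have hdR : (d : ℝ) ≠ 0 := by exact_mod_cast (Nat.pos_of_mem_divisors hd).ne'
    rw [hM]; push_cast
    field_simp
  rw [hcount, hmain, ← Finset.sum_sub_distrib, ← moebius_abs M hMpos]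
  refine (Finset.abs_sum_le_sum_abs _ _).trans (Finset.sum_le_sum fun d hd => ?_)
  rw [← mul_sub, abs_mul]
  refine mul_le_of_le_one_right (abs_nonneg _) (crt_class n hn d q (Nat.pos_of_mem_divisors hd) hqpos ?_ b)
  exact ((hcop.coprime_dvd_right (Nat.dvd_of_mem_divisors hd)).symm).pow_right _

end DS
end
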